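/- Let S be a set of n points in ℝ² and let k ≥ 1. If n ≥ 72k² + 2k − 1 and every line contains at most n − k points of S, then t₂ + t₃ ≥ k(n−k) − k(k−1). -/

import Mathlib

open Set

noncomputable section

/-- The plane. -/
abbrev Pt2 := EuclideanSpace ℝ (Fin 2)

/-- A line in the plane: the affine span of two distinct points. -/
def IsLine (L : Set Pt2) : Prop :=
  ∃ p q : Pt2, p ≠ q ∧ L = (affineSpan ℝ ({p, q} : Set Pt2) : Set Pt2)

/-- `lineCount S k` is the number of lines containing exactly `k` points of `S`. -/
def lineCount (S : Set Pt2) (k : ℕ) : ℕ :=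
  {L : Set Pt2 | IsLine L ∧ (S ∩ L).ncard = k}.ncard

section Blocks

open scoped Classical

/-- Twice the signed area of the triangle `p q r`. -/
def orient (p q r : Pt2) : ℝ :=
  (q 0 - p 0) * (r 1 - p 1) - (q 1 - p 1) * (r 0 - p 0)

lemma pt_ext {p q : Pt2} (h0 : p 0 = q 0) (h1 : p 1 = q 1) : p = q := by
  ext i
  fin_cases i
  · exact h0
  · exact h1

lemma orient_eq_zero_iff_exists {p q x : Pt2} (hpq : p ≠ q) :
    orient p q x = 0 ↔
      ∃ s : ℝ, x 0 = p 0 + s * (q 0 - p 0) ∧ x 1 = p 1 + s * (q 1 - p 1) := by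
  unfold orient
  constructor
  · intro h
    by_cases h0 : q 0 - p 0 = 0
    · have h1 : q 1 - p 1 ≠ 0 := fun h1 => hpq (pt_ext (by linarith) (by linarith))
      refine ⟨(x 1 - p 1) / (q 1 - p 1), ?_, ?_⟩
      · rw [h0] at h ⊢
        have : x 0 - p 0 = 0 := by
          have h' : (q 1 - p 1) * (x 0 - p 0) = 0 := by linarith
          exact (mul_eq_zero.mp h').resolve_left h1
        linarith
      · field_simp
        ring
    · refine ⟨(x 0 - p 0) / (q 0 - p 0), ?_, ?_⟩
      · field_simp
        ring
      · field_simp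
        linarith
  · rintro ⟨s, h0, h1⟩
    rw [h0, h1]
    ring

lemma mem_affineSpan_pair_iff_orient {p q x : Pt2} (hpq : p ≠ q) :
    x ∈ affineSpan ℝ ({p, q} : Set Pt2) ↔ orient p q x = 0 := by
  rw [orient_eq_zero_iff_exists hpq, mem_affineSpan_pair_iff_exists_lineMap_eq]
  refine exists_congr fun s => ?_
  simp only [AffineMap.lineMap_apply, vsub_eq_sub, vadd_eq_add]
  constructor
  · rintro rfl
    simp [add_comm]
  · rintro ⟨h0, h1⟩
    refine pt_ext ?_ ?_
    · simp [h0, add_comm]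
    · simp [h1, add_comm]

lemma orient_eq_zero_congr {p q a b : Pt2} (hpq : p ≠ q) (hab : a ≠ b)
    (ha : orient p q a = 0) (hb : orient p q b = 0) (x : Pt2) :
    orient p q x = 0 ↔ orient a b x = 0 := by
  obtain ⟨s, hs0, hs1⟩ := (orient_eq_zero_iff_exists hpq).1 ha
  obtain ⟨t, ht0, ht1⟩ := (orient_eq_zero_iff_exists hpq).1 hb
  have hst : t - s ≠ 0 := by
    intro h
    have : t = s := by linarith
    subst this
    exact hab (pt_ext (by rw [hs0, ht0]) (by rw [hs1, ht1]))
  have key : orient a b x = (t - s) * orient p q x := by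
    unfold orient
    rw [hs0, hs1, ht0, ht1]
    ring
  rw [key, mul_eq_zero, or_iff_right hst]

/-- The points of `S` on the line through `p` and `q`. -/
def block (S : Finset Pt2) (p q : Pt2) : Finset Pt2 :=
  S.filter fun x => orient p q x = 0

/-- The traces on `S` of the lines determined by `S`. -/
def blocks (S : Finset Pt2) : Finset (Finset Pt2) :=
  S.offDiag.image fun x => block S x.1 x.2

variable {S : Finset Pt2}

lemma mem_block {p q x : Pt2} : x ∈ block S p q ↔ x ∈ S ∧ orient p q x = 0 :=
  Finset.mem_filter

lemma mem_blocks {B : Finset Pt2} :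
    B ∈ blocks S ↔ ∃ p ∈ S, ∃ q ∈ S, p ≠ q ∧ block S p q = B := by
  simp only [blocks, Finset.mem_image, Finset.mem_offDiag, Prod.exists]
  constructor
  · rintro ⟨p, q, ⟨hp, hq, h⟩, e⟩
    exact ⟨p, hp, q, hq, h, e⟩
  · rintro ⟨p, hp, q, hq, h, e⟩
    exact ⟨p, q, ⟨hp, hq, h⟩, e⟩

lemma left_mem_block {p q : Pt2} (hp : p ∈ S) : p ∈ block S p q :=
  mem_block.2 ⟨hp, by unfold orient; ring⟩

lemma right_mem_block {p q : Pt2} (hq : q ∈ S) : q ∈ block S p q :=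
  mem_block.2 ⟨hq, by unfold orient; ring⟩

lemma block_mem_blocks {p q : Pt2} (hp : p ∈ S) (hq : q ∈ S) (h : p ≠ q) :
    block S p q ∈ blocks S :=
  mem_blocks.2 ⟨p, hp, q, hq, h, rfl⟩

lemma subset_of_mem_blocks {B : Finset Pt2} (hB : B ∈ blocks S) : B ⊆ S := by
  obtain ⟨p, -, q, -, -, rfl⟩ := mem_blocks.1 hB
  exact Finset.filter_subset _ _

lemma two_le_card_of_mem_blocks {B : Finset Pt2} (hB : B ∈ blocks S) : 2 ≤ B.card := by
  obtain ⟨p, hp, q, hq, h, rfl⟩ := mem_blocks.1 hB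
  exact Finset.one_lt_card.2 ⟨p, left_mem_block hp, q, right_mem_block hq, h⟩

lemma block_eq_of_mem {B : Finset Pt2} (hB : B ∈ blocks S) {a b : Pt2} (ha : a ∈ B)
    (hb : b ∈ B) (hab : a ≠ b) : block S a b = B := by
  obtain ⟨p, hp, q, hq, h, rfl⟩ := mem_blocks.1 hB
  ext x
  rw [mem_block, mem_block,
    orient_eq_zero_congr h hab (mem_block.1 ha).2 (mem_block.1 hb).2]

lemma block_eq_iff {B : Finset Pt2} (hB : B ∈ blocks S) {a b : Pt2} (ha : a ∈ S)
    (hb : b ∈ S) (hab : a ≠ b) : block S a b = B ↔ a ∈ B ∧ b ∈ B :=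
  ⟨fun h => h ▸ ⟨left_mem_block ha, right_mem_block hb⟩,
    fun h => block_eq_of_mem hB h.1 h.2 hab⟩

/-- Every set of pairs of distinct points splits according to the line joining them. -/
lemma card_eq_sum_blocks (T : Finset (Pt2 × Pt2)) (hT : T ⊆ S.offDiag) :
    T.card = ∑ B ∈ blocks S, (T.filter fun x => x.1 ∈ B ∧ x.2 ∈ B).card := by
  rw [Finset.card_eq_sum_card_fiberwise (f := fun x => block S x.1 x.2) (t := blocks S)
    (fun x hx => Finset.mem_image_of_mem _ (hT hx))]
  refine Finset.sum_congr rfl fun B hB => congrArg _ (Finset.filter_congr fun x hx => ?_)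
  obtain ⟨h1, h2, h3⟩ := Finset.mem_offDiag.1 (hT hx)
  exact block_eq_iff hB h1 h2 h3

/-- Rotating the line `a b` about both points until it first meets another point of `S`. -/
lemma exists_first_rotation {p q : Pt2} (hpq : p ≠ q) (hz : ∃ z ∈ S, orient p q z ≠ 0) :
    ∃ a b : Pt2, (a = p ∧ b = q ∨ a = q ∧ b = p) ∧ ∃ r ∈ S, 0 < orient a b r ∧
      (∀ z ∈ S, 0 < orient a b z → 0 ≤ orient a r z) ∧
      (∀ z ∈ S, orient a b z < 0 →
        0 ≤ (r 0 - a 0) * (b 1 - z 1) - (r 1 - a 1) * (b 0 - z 0)) := by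
  have hv : 0 < (q 0 - p 0) ^ 2 + (q 1 - p 1) ^ 2 := by
    by_contra! h
    have h0 : (q 0 - p 0) ^ 2 = 0 := by nlinarith [sq_nonneg (q 0 - p 0), sq_nonneg (q 1 - p 1)]
    have h1 : (q 1 - p 1) ^ 2 = 0 := by nlinarith [sq_nonneg (q 0 - p 0), sq_nonneg (q 1 - p 1)]
    exact hpq (pt_ext (by linarith [pow_eq_zero_iff (two_ne_zero) |>.1 h0])
      (by linarith [pow_eq_zero_iff (two_ne_zero) |>.1 h1]))
  let d : Pt2 → Pt2 → ℝ := fun a z =>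
    ((q 0 - p 0) * (z 0 - a 0) + (q 1 - p 1) * (z 1 - a 1)) / orient p q z
  let F : Pt2 → ℝ := fun z => if 0 < orient p q z then d p z else d q z
  obtain ⟨r, hr, hmax⟩ := Finset.exists_max_image (S.filter fun z => orient p q z ≠ 0) F
    (by obtain ⟨z, h1, h2⟩ := hz; exact ⟨z, Finset.mem_filter.2 ⟨h1, h2⟩⟩)
  obtain ⟨hrS, hr0⟩ := Finset.mem_filter.1 hr
  have hswap : ∀ z, orient q p z = - orient p q z := fun z => by unfold orient; ring
  have hmax' : ∀ z ∈ S, orient p q z ≠ 0 → F z ≤ F r := fun z hz h =>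
    hmax z (Finset.mem_filter.2 ⟨hz, h⟩)
  have hpos : ∀ X : ℝ, 0 ≤ ((q 0 - p 0) ^ 2 + (q 1 - p 1) ^ 2) * X → 0 ≤ X := fun X h =>
    nonneg_of_mul_nonneg_right h hv
  rcases lt_or_gt_of_ne hr0 with hr1 | hr1
  · refine ⟨q, p, Or.inr ⟨rfl, rfl⟩, r, hrS, by rw [hswap]; linarith, ?_, ?_⟩
    · intro z hz hz1
      rw [hswap] at hz1
      have h := hmax' z hz (by linarith)
      simp only [F, d, if_neg (not_lt.2 hr1.le), if_neg (show ¬ 0 < orient p q z by linarith)] at h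
      rw [← neg_div_neg_eq, ← neg_div_neg_eq (_ + _) (orient p q r),
        div_le_div_iff₀ (by linarith) (by linarith)] at h
      apply hpos
      unfold orient at h ⊢
      linarith
    · intro z hz hz1
      rw [hswap] at hz1
      have h := hmax' z hz (by linarith)
      simp only [F, d, if_neg (not_lt.2 hr1.le), if_pos (show 0 < orient p q z by linarith)] at h
      rw [← neg_div_neg_eq (_ + _) (orient p q r),
        div_le_div_iff₀ (by linarith) (by linarith)] at h
      apply hpos
      unfold orient at h
      linarith
  · refine ⟨p, q, Or.inl ⟨rfl, rfl⟩, r, hrS, hr1, ?_, ?_⟩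
    · intro z hz hz1
      have h := hmax' z hz (by linarith)
      simp only [F, d, if_pos hr1, if_pos hz1] at h
      rw [div_le_div_iff₀ (by linarith) (by linarith)] at h
      apply hpos
      unfold orient at h ⊢
      linarith
    · intro z hz hz1
      have h := hmax' z hz (by linarith)
      simp only [F, d, if_pos hr1, if_neg (not_lt.2 hz1.le)] at h
      rw [← neg_div_neg_eq, div_le_div_iff₀ (by linarith) (by linarith)] at h
      apply hpos
      unfold orient at h
      linarith

/-- Some linear functional separates the points of a finite set. -/
lemma exists_injOn_functional (S : Finset Pt2) :
    ∃ c : ℝ, ∀ p ∈ S, ∀ q ∈ S, p 0 + c * p 1 = q 0 + c * q 1 → p = q := by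
  let bad : Finset ℝ := S.offDiag.image fun x => (x.1 0 - x.2 0) / (x.2 1 - x.1 1)
  obtain ⟨c, hc⟩ := Infinite.exists_notMem_finset bad
  refine ⟨c, fun p hp q hq h => ?_⟩
  by_contra hpq
  refine hc (Finset.mem_image.2 ⟨(p, q), Finset.mem_offDiag.2 ⟨hp, hq, hpq⟩, ?_⟩)
  have h1 : q 1 - p 1 ≠ 0 := by
    intro h1
    have h1' : q 1 = p 1 := by linarith
    rw [h1'] at h
    exact hpq (pt_ext (by linarith) h1'.symm)
  simp only
  rw [div_eq_iff h1]
  linarith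

/-- `B'` is the line first met when the line `a b`, a gap of `B`, rotates, and it is met while
rotating about its extreme point `a`. The gap is recorded by its lower end `p`. -/
def RotatesTo (S : Finset Pt2) (g : Pt2 → ℝ) (x y : Finset Pt2 × Pt2) : Prop :=
  ∃ b ∈ x.1, y.2 ∈ x.1 ∧ (x.2 = y.2 ∧ g y.2 < g b ∨ x.2 = b ∧ g b < g y.2) ∧
    (∀ z ∈ x.1, ¬ (g y.2 < g z ∧ g z < g b) ∧ ¬ (g b < g z ∧ g z < g y.2)) ∧
    (∀ r ∈ y.1, r ≠ y.2 → 0 < orient y.2 b r) ∧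
    ∀ r ∈ y.1, ∀ z ∈ S, 0 < orient y.2 b z → 0 ≤ orient y.2 r z

lemma RotatesTo.left_unique {c : ℝ}
    (hc : ∀ p ∈ S, ∀ q ∈ S, p 0 + c * p 1 = q 0 + c * q 1 → p = q)
    {x x' y : Finset Pt2 × Pt2} (hx : x.1 ∈ blocks S) (hx' : x'.1 ∈ blocks S)
    (hy : y.1 ∈ blocks S)
    (h : RotatesTo S (fun p => p 0 + c * p 1) x y)
    (h' : RotatesTo S (fun p => p 0 + c * p 1) x' y) : x = x' := by
  obtain ⟨B, p⟩ := x
  obtain ⟨B', p'⟩ := x'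
  obtain ⟨C, a⟩ := y
  obtain ⟨b, hb, ha, hp, hgap, hr, hmin⟩ := h
  obtain ⟨b', hb', ha', hp', hgap', hr', hmin'⟩ := h'
  dsimp only at *
  obtain ⟨r, hrC, hra⟩ := Finset.exists_mem_ne (two_le_card_of_mem_blocks hy) a
  have h1 := hr r hrC hra
  have h2 := hr' r hrC hra
  have hab : a ≠ b := by
    rintro rfl
    simp at hp
  have hab' : a ≠ b' := by
    rintro rfl
    simp at hp'
  have hbS := subset_of_mem_blocks hx hb
  have hbS' := subset_of_mem_blocks hx' hb'
  have e1 : ¬ 0 < orient a b b' := fun h => by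
    have := hmin r hrC b' hbS' h
    have e : orient a r b' = - orient a b' r := by unfold orient; ring
    linarith
  have e2 : ¬ 0 < orient a b' b := fun h => by
    have := hmin' r hrC b hbS h
    have e : orient a r b = - orient a b r := by unfold orient; ring
    linarith
  have e3 : orient a b b' = - orient a b' b := by unfold orient; ring
  have e0 : orient a b b' = 0 := by linarith
  have hBB : B = B' := by
    rw [← block_eq_of_mem hx' ha' hb' hab']
    have : b' ∈ B := by
      rw [← block_eq_of_mem hx ha hb hab]
      exact mem_block.2 ⟨hbS', e0⟩
    exact (block_eq_of_mem hx ha this hab').symm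
  subst hBB
  obtain ⟨s, hs0, hs1⟩ := (orient_eq_zero_iff_exists hab).1 e0
  have hs : 0 < s := by
    have : orient a b' r = s * orient a b r := by
      unfold orient
      rw [hs0, hs1]
      ring
    rw [this] at h2
    exact pos_of_mul_pos_left h2 h1.le
  have hg : b' 0 + c * b' 1 - (a 0 + c * a 1) = s * (b 0 + c * b 1 - (a 0 + c * a 1)) := by
    rw [hs0, hs1]
    ring
  obtain ⟨u1, u2⟩ := hgap b' hb'
  obtain ⟨v1, v2⟩ := hgap' b hb
  rw [not_and, not_lt] at u1 u2 v1 v2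
  rcases hp with ⟨rfl, hp⟩ | ⟨rfl, hp⟩
  · rcases hp' with ⟨rfl, hp'⟩ | ⟨rfl, hp'⟩
    · rfl
    · nlinarith
  · rcases hp' with ⟨rfl, hp'⟩ | ⟨rfl, hp'⟩
    · nlinarith
    · rw [hc p hbS p' hbS' (le_antisymm (not_lt.1 fun h => ?_) (not_lt.1 fun h => ?_))]
      · linarith [v2 h]
      · linarith [u2 h]

/-- The lowest and the highest points of the lines determined by `S`. -/
def IsEndpoint (g : Pt2 → ℝ) (y : Finset Pt2 × Pt2) : Prop :=
  (∀ q ∈ y.1, g q ≤ g y.2) ∨ ∀ q ∈ y.1, g y.2 ≤ g q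

lemma exists_rotatesTo (c : ℝ) {B : Finset Pt2} (hB : B ∈ blocks S) (hBS : B ≠ S) {p : Pt2}
    (hp : p ∈ B) (hq : ∃ q ∈ B, p 0 + c * p 1 < q 0 + c * q 1) :
    ∃ C ∈ blocks S, ∃ a ∈ C, IsEndpoint (fun p => p 0 + c * p 1) (C, a) ∧
      RotatesTo S (fun p => p 0 + c * p 1) (B, p) (C, a) := by
  set g : Pt2 → ℝ := fun p => p 0 + c * p 1 with hg
  obtain ⟨q, hqm, hqmin⟩ := Finset.exists_min_image (B.filter fun q => g p < g q) g
    (by obtain ⟨q, h1, h2⟩ := hq; exact ⟨q, Finset.mem_filter.2 ⟨h1, h2⟩⟩)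
  obtain ⟨hqB, hpq⟩ := Finset.mem_filter.1 hqm
  have hne : p ≠ q := by
    rintro rfl
    exact lt_irrefl _ hpq
  have hgap : ∀ z ∈ B, ¬ (g p < g z ∧ g z < g q) := fun z hz h =>
    absurd (hqmin z (Finset.mem_filter.2 ⟨hz, h.1⟩)) (not_le.2 h.2)
  have hz : ∃ z ∈ S, orient p q z ≠ 0 := by
    by_contra! h
    refine hBS (Finset.Subset.antisymm (subset_of_mem_blocks hB) fun z hz => ?_)
    rw [← block_eq_of_mem hB hp hqB hne]
    exact mem_block.2 ⟨hz, h z hz⟩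
  obtain ⟨a, b, hab, r, hrS, hr, h1, h2⟩ := exists_first_rotation hne hz
  have haB : a ∈ B := by rcases hab with ⟨rfl, rfl⟩ | ⟨rfl, rfl⟩ <;> assumption
  have hbB : b ∈ B := by rcases hab with ⟨rfl, rfl⟩ | ⟨rfl, rfl⟩ <;> assumption
  have har : a ≠ r := by
    rintro rfl
    unfold orient at hr
    linarith
  have haS := subset_of_mem_blocks hB haB
  have key : ∀ x ∈ block S a r, x ≠ a →
      ∃ s : ℝ, 0 < s ∧ x 0 = a 0 + s * (r 0 - a 0) ∧ x 1 = a 1 + s * (r 1 - a 1) := by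
    intro x hx hxa
    obtain ⟨hxS, hx⟩ := mem_block.1 hx
    obtain ⟨s, hs0, hs1⟩ := (orient_eq_zero_iff_exists har).1 hx
    refine ⟨s, ?_, hs0, hs1⟩
    have e : orient a b x = s * orient a b r := by
      unfold orient
      rw [hs0, hs1]
      ring
    by_contra! hs
    rcases hs.lt_or_eq with hs | rfl
    · have h := h2 x hxS (by rw [e]; exact mul_neg_of_neg_of_pos hs hr)
      have : (r 0 - a 0) * (b 1 - x 1) - (r 1 - a 1) * (b 0 - x 0) = - orient a b r := by
        unfold orient
        rw [hs0, hs1]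
        ring
      linarith
    · exact hxa (pt_ext (by linarith) (by linarith))
  refine ⟨block S a r, block_mem_blocks haS hrS har, a, left_mem_block haS, ?_, b, hbB, haB,
    ?_, ?_, ?_, ?_⟩
  · have key' : ∀ x ∈ block S a r, ∃ s : ℝ, 0 ≤ s ∧ g x = g a + s * (g r - g a) := by
      intro x hx
      by_cases hxa : x = a
      · exact ⟨0, le_rfl, by rw [hxa]; ring⟩
      · obtain ⟨s, hs, hs0, hs1⟩ := key x hx hxa
        refine ⟨s, hs.le, ?_⟩
        simp only [hg]
        rw [hs0, hs1]
        ring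
    rcases le_total (g r) (g a) with h | h
    · refine Or.inl fun x hx => ?_
      obtain ⟨s, hs, e⟩ := key' x hx
      change g x ≤ g a
      rw [e]
      nlinarith
    · refine Or.inr fun x hx => ?_
      obtain ⟨s, hs, e⟩ := key' x hx
      change g a ≤ g x
      rw [e]
      nlinarith
  · rcases hab with ⟨rfl, rfl⟩ | ⟨rfl, rfl⟩
    · exact Or.inl ⟨rfl, hpq⟩
    · exact Or.inr ⟨rfl, hpq⟩
  · intro z hz
    have := hgap z hz
    rcases hab with ⟨rfl, rfl⟩ | ⟨rfl, rfl⟩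
    · exact ⟨this, fun h => lt_asymm hpq (h.1.trans h.2)⟩
    · exact ⟨fun h => lt_asymm hpq (h.1.trans h.2), this⟩
  · intro x hx hxa
    obtain ⟨s, hs, hs0, hs1⟩ := key x hx hxa
    have e : orient a b x = s * orient a b r := by
      unfold orient
      rw [hs0, hs1]
      ring
    rw [e]
    exact mul_pos hs hr
  · intro x hx z hz hz1
    change 0 ≤ orient a x z
    by_cases hxa : x = a
    · subst hxa
      unfold orient
      linarith
    · obtain ⟨s, hs, hs0, hs1⟩ := key x hx hxa
      have e : orient a x z = s * orient a r z := by
        unfold orient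
        rw [hs0, hs1]
        ring
      rw [e]
      exact mul_nonneg hs.le (h1 z hz hz1)

/-- The points of `B` at which `g` is maximal. -/
def highest (g : Pt2 → ℝ) (B : Finset Pt2) : Finset Pt2 :=
  B.filter fun p => ∀ q ∈ B, g q ≤ g p

lemma mem_highest {g : Pt2 → ℝ} {B : Finset Pt2} {p : Pt2} :
    p ∈ highest g B ↔ p ∈ B ∧ ∀ q ∈ B, g q ≤ g p :=
  Finset.mem_filter

lemma card_highest_le_one {g : Pt2 → ℝ} {B : Finset Pt2} (hg : Set.InjOn g B) :
    (highest g B).card ≤ 1 := by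
  refine Finset.card_le_one.2 fun a ha b hb => ?_
  obtain ⟨ha1, ha2⟩ := mem_highest.1 ha
  obtain ⟨hb1, hb2⟩ := mem_highest.1 hb
  exact hg ha1 hb1 (le_antisymm (hb2 a ha1) (ha2 b hb1))

lemma card_filter_snd_mem {f : Finset Pt2 → Finset Pt2} (hf : ∀ B ∈ blocks S, f B ⊆ S) :
    ((blocks S ×ˢ S).filter fun x => x.2 ∈ f x.1).card = ∑ B ∈ blocks S, (f B).card := by
  rw [Finset.card_filter, Finset.sum_product]
  refine Finset.sum_congr rfl fun B hB => ?_
  dsimp only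
  rw [← Finset.card_filter, Finset.filter_mem_eq_inter, Finset.inter_eq_right.2 (hf B hB)]

/-- A form of Melchior's inequality: on average, a line determined by a noncollinear set contains
at most three of its points. -/
theorem sum_card_blocks_le (hS : S ∉ blocks S) :
    ∑ B ∈ blocks S, B.card ≤ 3 * (blocks S).card := by
  obtain ⟨c, hc⟩ := exists_injOn_functional S
  set g : Pt2 → ℝ := fun p => p 0 + c * p 1 with hg
  have hinj : ∀ B ∈ blocks S, Set.InjOn g B := fun B hB p hp q hq h =>
    hc p (subset_of_mem_blocks hB hp) q (subset_of_mem_blocks hB hq) h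
  have hinj' : ∀ B ∈ blocks S, Set.InjOn (-g) B := fun B hB p hp q hq h =>
    hinj B hB hp hq (neg_injective h)
  have hsub : ∀ g : Pt2 → ℝ, ∀ B, highest g B ⊆ B := fun g B => Finset.filter_subset _ _
  have hX := card_filter_snd_mem (S := S) (f := fun B => B \ highest g B)
    fun B hB => Finset.sdiff_subset.trans (subset_of_mem_blocks hB)
  have hY := card_filter_snd_mem (S := S) (f := fun B => highest g B ∪ highest (-g) B)
    fun B hB => (Finset.union_subset (hsub _ _) (hsub _ _)).trans (subset_of_mem_blocks hB)
  have hXY : ((blocks S ×ˢ S).filter fun x => x.2 ∈ x.1 \ highest g x.1).card ≤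
      ((blocks S ×ˢ S).filter fun x => x.2 ∈ highest g x.1 ∪ highest (-g) x.1).card := by
    refine Finset.card_le_card_of_forall_subsingleton (RotatesTo S g) ?_ ?_
    · rintro ⟨B, p⟩ hx
      obtain ⟨hx1, hx2⟩ := Finset.mem_filter.1 hx
      obtain ⟨hpB, hpm⟩ := Finset.mem_sdiff.1 hx2
      have hB := (Finset.mem_product.1 hx1).1
      have hq : ∃ q ∈ B, g p < g q := by
        by_contra! h
        exact hpm (mem_highest.2 ⟨hpB, h⟩)
      obtain ⟨C, hC, a, ha, hext, hrot⟩ :=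
        exists_rotatesTo c hB (fun h => hS (by rw [← h] at hB ⊢; exact hB)) hpB hq
      refine ⟨(C, a), Finset.mem_filter.2 ⟨Finset.mem_product.2
        ⟨hC, subset_of_mem_blocks hC ha⟩, Finset.mem_union.2 ?_⟩, hrot⟩
      exact hext.imp (fun h => mem_highest.2 ⟨ha, h⟩) fun h =>
        mem_highest.2 ⟨ha, fun q hq => neg_le_neg (h q hq)⟩
    · intro y hy x hx x' hx'
      exact RotatesTo.left_unique hc (Finset.mem_product.1 (Finset.mem_filter.1 hx.1).1).1
        (Finset.mem_product.1 (Finset.mem_filter.1 hx'.1).1).1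
        (Finset.mem_product.1 (Finset.mem_filter.1 hy).1).1 hx.2 hx'.2
  rw [hX, hY] at hXY
  have h1 : ∑ B ∈ blocks S, B.card ≤ ∑ B ∈ blocks S, ((B \ highest g B).card + 1) :=
    Finset.sum_le_sum fun B hB => by
      have := Finset.le_card_sdiff (highest g B) B
      have := card_highest_le_one (hinj B hB)
      omega
  have h2 : ∑ B ∈ blocks S, (highest g B ∪ highest (-g) B).card ≤ ∑ B ∈ blocks S, 2 :=
    Finset.sum_le_sum fun B hB => by
      have := Finset.card_union_le (highest g B) (highest (-g) B)
      have := card_highest_le_one (hinj B hB)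
      have := card_highest_le_one (hinj' B hB)
      omega
  rw [Finset.sum_add_distrib] at h1
  simp only [Finset.sum_const, smul_eq_mul] at h1 h2
  omega

lemma coe_block_eq {p q : Pt2} (hpq : p ≠ q) :
    (block S p q : Set Pt2) = (S : Set Pt2) ∩ affineSpan ℝ ({p, q} : Set Pt2) := by
  ext x
  rw [Finset.mem_coe, mem_block, Set.mem_inter_iff, Finset.mem_coe, SetLike.mem_coe,
    mem_affineSpan_pair_iff_orient hpq]

lemma exists_isLine_inter_eq {B : Finset Pt2} (hB : B ∈ blocks S) :
    ∃ L, IsLine L ∧ (S : Set Pt2) ∩ L = B := by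
  obtain ⟨p, -, q, -, h, rfl⟩ := mem_blocks.1 hB
  exact ⟨_, ⟨p, q, h, rfl⟩, (coe_block_eq h).symm⟩

lemma IsLine.eq_of_mem {L M : Set Pt2} (hL : IsLine L) (hM : IsLine M) {a b : Pt2}
    (hab : a ≠ b) (haL : a ∈ L) (hbL : b ∈ L) (haM : a ∈ M) (hbM : b ∈ M) : L = M := by
  obtain ⟨p, q, hpq, rfl⟩ := hL
  obtain ⟨p', q', hpq', rfl⟩ := hM
  rw [SetLike.mem_coe, mem_affineSpan_pair_iff_orient hpq] at haL hbL
  rw [SetLike.mem_coe, mem_affineSpan_pair_iff_orient hpq'] at haM hbM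
  ext x
  rw [SetLike.mem_coe, mem_affineSpan_pair_iff_orient hpq, SetLike.mem_coe,
    mem_affineSpan_pair_iff_orient hpq', orient_eq_zero_congr hpq hab haL hbL,
    orient_eq_zero_congr hpq' hab haM hbM]

lemma card_blocks_filter_le_lineCount (S : Finset Pt2) {j : ℕ} (hj : 2 ≤ j) :
    ((blocks S).filter fun B => B.card = j).card ≤ lineCount S j := by
  have hinj : Set.InjOn (fun L => (S : Set Pt2) ∩ L)
      {L : Set Pt2 | IsLine L ∧ ((S : Set Pt2) ∩ L).ncard = j} := by
    rintro L ⟨hL, hLj⟩ M ⟨hM, -⟩ h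
    dsimp only at h
    obtain ⟨a, ha, b, hb, hab⟩ := (Set.one_lt_ncard_iff_nontrivial_and_finite.1
      (show 1 < ((S : Set Pt2) ∩ L).ncard by omega)).1
    have ha' := h ▸ ha
    have hb' := h ▸ hb
    exact hL.eq_of_mem hM hab ha.2 hb.2 ha'.2 hb'.2
  rw [lineCount, ← hinj.ncard_image, ← Set.ncard_coe_finset,
    ← Set.ncard_image_of_injective _ (Finset.coe_injective (α := Pt2))]
  refine Set.ncard_le_ncard ?_ ?_
  · rintro _ ⟨B, hB, rfl⟩
    obtain ⟨hB, hBj⟩ := Finset.mem_filter.1 (Finset.mem_coe.1 hB)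
    obtain ⟨L, hL, hLB⟩ := exists_isLine_inter_eq hB
    exact ⟨L, ⟨hL, by rw [hLB, Set.ncard_coe_finset, hBj]⟩, hLB⟩
  · refine S.finite_toSet.finite_subsets.subset ?_
    rintro _ ⟨L, -, rfl⟩
    exact Set.inter_subset_left

/-- The number of lines containing two or three points of `S`. -/
def fewCount (S : Finset Pt2) : ℕ :=
  ((blocks S).filter fun B => B.card ≤ 3).card

lemma fewCount_le (S : Finset Pt2) : fewCount S ≤ lineCount S 2 + lineCount S 3 := by
  refine le_trans ?_ (add_le_add (card_blocks_filter_le_lineCount S le_rfl)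
    (card_blocks_filter_le_lineCount S (Nat.le_succ 2)))
  refine (Finset.card_le_card fun B hB => ?_).trans (Finset.card_union_le _ _)
  obtain ⟨hB, h3⟩ := Finset.mem_filter.1 hB
  have := two_le_card_of_mem_blocks hB
  rw [Finset.mem_union, Finset.mem_filter, Finset.mem_filter]
  rcases (show B.card = 2 ∨ B.card = 3 by omega) with h | h
  · exact Or.inl ⟨hB, h⟩
  · exact Or.inr ⟨hB, h⟩

lemma sum_card_blocks_le_fewCount (hS : S ∉ blocks S) :
    ∑ B ∈ blocks S, B.card ≤ 6 * fewCount S := by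
  have h1 := sum_card_blocks_le hS
  have h2 : ∑ B ∈ blocks S, (B.card + 12) ≤
      ∑ B ∈ blocks S, (4 * B.card + 6 * if B.card ≤ 3 then 1 else 0) :=
    Finset.sum_le_sum fun B hB => by
      have := two_le_card_of_mem_blocks hB
      split_ifs <;> omega
  rw [Finset.sum_add_distrib, Finset.sum_add_distrib, ← Finset.mul_sum, ← Finset.mul_sum,
    ← Finset.card_filter, Finset.sum_const, smul_eq_mul] at h2
  unfold fewCount
  omega

/-- The number of lines determined by `S` through `p`. -/
def degree (S : Finset Pt2) (p : Pt2) : ℕ :=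
  ((blocks S).filter fun B => p ∈ B).card

lemma sum_degree (S : Finset Pt2) : ∑ p ∈ S, degree S p = ∑ B ∈ blocks S, B.card := by
  simp only [degree, Finset.card_filter]
  rw [Finset.sum_comm]
  refine Finset.sum_congr rfl fun B hB => ?_
  rw [← Finset.card_filter, Finset.filter_mem_eq_inter,
    Finset.inter_eq_right.2 (subset_of_mem_blocks hB)]

lemma card_le_degree {B : Finset Pt2} (hB : B ∈ blocks S) {x : Pt2} (hx : x ∈ S)
    (hxB : x ∉ B) : B.card ≤ degree S x := by
  have hne : ∀ y ∈ B, x ≠ y := fun y hy h => hxB (h ▸ hy)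
  refine Finset.card_le_card_of_injOn (fun y => block S x y) (fun y hy => ?_) ?_
  · exact Finset.mem_coe.2 (Finset.mem_filter.2
      ⟨block_mem_blocks hx (subset_of_mem_blocks hB hy) (hne y hy), left_mem_block hx⟩)
  · intro y hy z hz h
    by_contra hyz
    dsimp only at h
    have hyS := subset_of_mem_blocks hB hy
    have hzS := subset_of_mem_blocks hB hz
    have h1 := block_eq_of_mem (block_mem_blocks hx hyS (hne y hy)) (right_mem_block hyS)
      (h ▸ right_mem_block hzS) hyz
    have h2 := block_eq_of_mem hB hy hz hyz
    exact hxB (h2 ▸ h1 ▸ left_mem_block hx)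

lemma card_le_degree_mul {p : Pt2} (hp : p ∈ S) {m : ℕ}
    (h : ∀ B ∈ blocks S, p ∈ B → B.card ≤ m + 1) : S.card ≤ degree S p * m + 1 := by
  have hT : ({p} ×ˢ S.erase p : Finset (Pt2 × Pt2)) ⊆ S.offDiag := by
    rintro ⟨a, b⟩ hab
    obtain ⟨ha, hb⟩ := Finset.mem_product.1 hab
    rw [Finset.mem_singleton] at ha
    dsimp only at ha hb
    subst ha
    exact Finset.mem_offDiag.2 ⟨hp, Finset.mem_of_mem_erase hb, (Finset.ne_of_mem_erase hb).symm⟩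
  have h1 := card_eq_sum_blocks _ hT
  have h2 : ∑ B ∈ blocks S, (({p} ×ˢ S.erase p).filter fun x => x.1 ∈ B ∧ x.2 ∈ B).card ≤
      ∑ B ∈ blocks S, (if p ∈ B then 1 else 0) * m := by
    refine Finset.sum_le_sum fun B hB => ?_
    have e : ({p} ×ˢ S.erase p).filter (fun x => x.1 ∈ B ∧ x.2 ∈ B) =
        ({p} : Finset Pt2).filter (fun a => a ∈ B) ×ˢ (S.erase p).filter (fun a => a ∈ B) := by
      ext ⟨a, b⟩
      simp only [Finset.mem_filter, Finset.mem_product]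
      tauto
    rw [e, Finset.card_product]
    split_ifs with hpB
    · refine Nat.mul_le_mul ((Finset.card_filter_le _ _).trans (by simp)) ?_
      have : ((S.erase p).filter fun a => a ∈ B).card ≤ (B.erase p).card :=
        Finset.card_le_card fun x hx => by
          obtain ⟨hx1, hx2⟩ := Finset.mem_filter.1 hx
          exact Finset.mem_erase.2 ⟨Finset.ne_of_mem_erase hx1, hx2⟩
      rw [Finset.card_erase_of_mem hpB] at this
      have := h B hB hpB
      omega
    · rw [Finset.filter_singleton, if_neg hpB]
      simp
  rw [← Finset.sum_mul, ← Finset.card_filter, ← h1, Finset.card_product, Finset.card_singleton,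
    Finset.card_erase_of_mem hp] at h2
  unfold degree
  omega

/-- Counting the lines joining the points of a line to the points off it. -/
lemma two_mul_card_sdiff_mul_card_le {B : Finset Pt2} (hB : B ∈ blocks S) :
    2 * ((S \ B).card * B.card) + (S \ B).card ≤
      2 * fewCount S + (S \ B).card * (S \ B).card := by
  have hBS := subset_of_mem_blocks hB
  have h1 := card_eq_sum_blocks (S := S) ((S \ B) ×ˢ B) (by
    rintro ⟨a, b⟩ hab
    obtain ⟨ha, hb⟩ := Finset.mem_product.1 hab
    obtain ⟨ha, ha'⟩ := Finset.mem_sdiff.1 ha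
    exact Finset.mem_offDiag.2 ⟨ha, hBS hb, fun h => ha' (by
      dsimp only at h hb ⊢
      exact h ▸ hb)⟩)
  have h2 := card_eq_sum_blocks (S := S) (S \ B).offDiag
    (Finset.offDiag_mono Finset.sdiff_subset)
  have h3 : ∑ C ∈ blocks S,
        2 * (((S \ B) ×ˢ B).filter fun x => x.1 ∈ C ∧ x.2 ∈ C).card ≤
      ∑ C ∈ blocks S, (2 * (if C.card ≤ 3 then 1 else 0) +
        ((S \ B).offDiag.filter fun x => x.1 ∈ C ∧ x.2 ∈ C).card) := by
    refine Finset.sum_le_sum fun C hC => ?_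
    have e1 : (S \ B).offDiag.filter (fun x => x.1 ∈ C ∧ x.2 ∈ C) = (C \ B).offDiag := by
      have := @subset_of_mem_blocks _ _ hC
      ext ⟨a, b⟩
      simp only [Finset.mem_filter, Finset.mem_offDiag, Finset.mem_sdiff]
      grind
    have e2 : ((S \ B) ×ˢ B).filter (fun x => x.1 ∈ C ∧ x.2 ∈ C) = (C \ B) ×ˢ (C ∩ B) := by
      have := @subset_of_mem_blocks _ _ hC
      ext ⟨a, b⟩
      simp only [Finset.mem_filter, Finset.mem_product, Finset.mem_sdiff, Finset.mem_inter]
      grind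
    rw [e1, e2, Finset.card_product, Finset.offDiag_card]
    by_cases hCB : C = B
    · simp [hCB]
    have h4 : (C ∩ B).card ≤ 1 := by
      refine Finset.card_le_one.2 fun a ha b hb => ?_
      by_contra hab
      obtain ⟨ha1, ha2⟩ := Finset.mem_inter.1 ha
      obtain ⟨hb1, hb2⟩ := Finset.mem_inter.1 hb
      exact hCB ((block_eq_of_mem hC ha1 hb1 hab).symm.trans (block_eq_of_mem hB ha2 hb2 hab))
    have h5 := Finset.card_sdiff_add_card_inter C B
    rw [← h5]
    generalize (C \ B).card = o at *
    generalize (C ∩ B).card = b at *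
    rw [← Nat.mul_sub_one]
    interval_cases b
    · simp
    · split_ifs with h
      · have : o ≤ 2 := by omega
        interval_cases o <;> simp
      · have := Nat.mul_le_mul_left o (show 2 ≤ o - 1 by omega)
        omega
  rw [Finset.sum_add_distrib, ← Finset.mul_sum, ← Finset.mul_sum, ← Finset.card_filter, ← h1,
    ← h2, Finset.card_product, Finset.offDiag_card] at h3
  have := Nat.le_mul_self (S \ B).card
  unfold fewCount
  omega

lemma mul_le_fewCount {k : ℕ} (hk : 1 ≤ k) (hbig : 72 * k ^ 2 + 2 * k ≤ S.card + 1)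
    (hline : ∀ B ∈ blocks S, B.card + k ≤ S.card) :
    k * S.card + k ≤ fewCount S + 2 * k ^ 2 := by
  have hS : S ∉ blocks S := fun h => by
    have := hline S h
    omega
  have hsum := sum_card_blocks_le_fewCount hS
  rw [← sum_degree] at hsum
  have hkk : k ≤ k ^ 2 := by nlinarith
  by_cases hdeg : ∀ p ∈ S, 6 * k ≤ degree S p
  · have := Finset.card_nsmul_le_sum S _ _ hdeg
    rw [smul_eq_mul] at this
    nlinarith
  push Not at hdeg
  obtain ⟨p, hp, hpdeg⟩ := hdeg
  obtain ⟨B, hB, hBcard⟩ : ∃ B ∈ blocks S, 12 * k < B.card := by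
    by_contra! h
    have h1 := card_le_degree_mul hp (m := 12 * k - 1) fun B hB _ => by
      have := h B hB
      omega
    have h2 : degree S p * (12 * k - 1) ≤ (6 * k - 1) * (12 * k - 1) :=
      Nat.mul_le_mul_right _ (by omega)
    zify [show 1 ≤ 6 * k by omega, show 1 ≤ 12 * k by omega] at h1 h2 hbig hk
    nlinarith
  have hcard := Finset.card_sdiff_add_card_eq_card (subset_of_mem_blocks hB)
  have hBk := hline B hB
  by_cases hm : 2 * B.card ≤ S.card
  · have h1 : ∑ p ∈ S \ B, degree S p ≤ ∑ p ∈ S, degree S p :=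
      Finset.sum_le_sum_of_subset Finset.sdiff_subset
    have h2 : (S \ B).card • B.card ≤ ∑ p ∈ S \ B, degree S p :=
      Finset.card_nsmul_le_sum _ _ _ fun x hx =>
        card_le_degree hB (Finset.mem_sdiff.1 hx).1 (Finset.mem_sdiff.1 hx).2
    rw [smul_eq_mul] at h2
    have h3 : (S \ B).card * (12 * k) ≤ (S \ B).card * B.card :=
      Nat.mul_le_mul_left _ hBcard.le
    have h4 : S.card * (6 * k) ≤ (2 * (S \ B).card) * (6 * k) :=
      Nat.mul_le_mul_right _ (by omega)
    nlinarith
  · have h1 := two_mul_card_sdiff_mul_card_le hB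
    generalize (S \ B).card = r at *
    generalize fewCount S = t at *
    rw [← hcard] at hbig hBk hm ⊢
    generalize B.card = m at *
    have hrk : k ≤ r := by omega
    have h72 : 72 * k ≤ r + m := by nlinarith
    zify at *
    nlinarith [mul_nonneg (sub_nonneg.2 hrk) (show (0 : ℤ) ≤ 2 * m - r - 3 * k + 1 by linarith)]

end Blocks

theorem stmt4 (S : Set Pt2) (hS : S.Finite) (n k : ℕ) (hn : S.ncard = n)
    (hk : 1 ≤ k) (hbig : (n : ℤ) ≥ 72 * k ^ 2 + 2 * k - 1)
    (hline : ∀ L : Set Pt2, IsLine L → ((S ∩ L).ncard : ℤ) ≤ (n : ℤ) - k) :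
    (lineCount S 2 + lineCount S 3 : ℤ) ≥ (k : ℤ) * (n - k) - k * (k - 1) := by
  lift S to Finset Pt2 using hS
  rw [Set.ncard_coe_finset] at hn
  subst hn
  have h := mul_le_fewCount hk (by zify; linarith) fun B hB => by
    obtain ⟨L, hL, hLB⟩ := exists_isLine_inter_eq hB
    have := hline L hL
    rw [hLB, Set.ncard_coe_finset] at this
    zify
    linarith
  have h' := fewCount_le S
  zify at h h'
  linarith
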